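/- arXiv:1507.02580 — 4 statements merged into one kernel-verified Lean document; each statement's English description precedes it below -/
import Mathlib

section
/- Let A be a unital complex C*-algebra, let a, b ∈ A be self-adjoint, and let ε > 0 satisfy ε·1 ≤ b. Write Im(x) = (x − x*)/(2i) for x ∈ A. Then Im((a + i·b)⁻¹) ≤ 0; in fact −Im((a + i·b)⁻¹) is positive and invertible, so the imaginary part of the resolvent is strictly negative. -/
open Complex

/-- The imaginary part `Im(x) = (x - x*)/(2i)` of an element of a complex star algebra. -/
noncomputable def imPart {A : Type*} [NormedRing A] [StarRing A]
    [NormedAlgebra ℂ A] [StarModule ℂ A] (x : A) : A :=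
  ((2 * Complex.I)⁻¹ : ℂ) • (x - star x)

/-- If `c` is self-adjoint, then `c + i` is invertible. -/
theorem IsSelfAdjoint.isUnit_add_I {A : Type*} [CStarAlgebra A] {c : A} (hc : IsSelfAdjoint c) :
    IsUnit (c + Complex.I • (1 : A)) := by
  have h : -Complex.I ∉ spectrum ℂ c := fun hmem => by
    simpa using congrArg Complex.im (hc.mem_spectrum_eq_re hmem)
  rw [spectrum.notMem_iff] at h
  convert h.neg using 1
  rw [Algebra.algebraMap_eq_smul_one, neg_smul]
  abel

/-- If `a` is self-adjoint and `b` is strictly positive, then `a + i b` is invertible. -/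
theorem IsStrictlyPositive.isUnit_add_I_smul {A : Type*} [CStarAlgebra A] [PartialOrder A]
    [StarOrderedRing A] {a b : A} (ha : IsSelfAdjoint a) (hb : IsStrictlyPositive b) :
    IsUnit (a + Complex.I • b) := by
  have hs : IsSelfAdjoint (CFC.sqrt b) := (CFC.sqrt_nonneg b).isSelfAdjoint
  have hss : CFC.sqrt b * CFC.sqrt b = b := CFC.sqrt_mul_sqrt_self b hb.nonneg
  obtain ⟨s, hsu⟩ : IsUnit (CFC.sqrt b) := (CFC.isUnit_sqrt_iff b hb.nonneg).mpr hb.isUnit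
  rw [← hsu] at hs hss
  have hinv : star (↑s⁻¹ : A) = ↑s⁻¹ := by
    rw [← Units.coe_star, star_inv, show star s = s from Units.ext hs]
  have hc : IsSelfAdjoint (↑s⁻¹ * a * ↑s⁻¹ : A) := by
    simpa only [hinv] using ha.conjugate (↑s⁻¹ : A)
  have key : a + Complex.I • b = s * (↑s⁻¹ * a * ↑s⁻¹ + Complex.I • (1 : A)) * s := by
    simp [mul_add, add_mul, mul_assoc, hss]
  rw [key]
  exact (s.isUnit.mul hc.isUnit_add_I).mul s.isUnit

/-- Conjugation formula for the imaginary part of an inverse: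
`-Im((a + i b)⁻¹) = ((a + i b)⁻¹)* b (a + i b)⁻¹`. -/
theorem neg_imPart_inverse {A : Type*} [NormedRing A] [StarRing A]
    [NormedAlgebra ℂ A] [StarModule ℂ A] {a b : A} (ha : IsSelfAdjoint a)
    (hb : IsSelfAdjoint b) (hz : IsUnit (a + Complex.I • b)) :
    -imPart (Ring.inverse (a + Complex.I • b)) =
      star (Ring.inverse (a + Complex.I • b)) * b * Ring.inverse (a + Complex.I • b) := by
  set z := a + Complex.I • b with hzdef
  set r := Ring.inverse z
  have hzr : z * r = 1 := Ring.mul_inverse_cancel z hz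
  have hrz : star r * star z = 1 := by rw [← star_mul, hzr, star_one]
  have hdiff : z - star z = (2 * Complex.I) • b := by
    rw [hzdef, star_add, star_smul, ha.star_eq, hb.star_eq, Complex.star_def, Complex.conj_I]
    module
  have hr : r - star r = -((2 * Complex.I) • (star r * b * r)) := by
    calc r - star r = star r * star z * r - star r * (z * r) := by rw [hrz, hzr, one_mul, mul_one]
      _ = -(star r * (z - star z) * r) := by noncomm_ring
      _ = -((2 * Complex.I) • (star r * b * r)) := by
        rw [hdiff, mul_smul_comm, smul_mul_assoc]
  rw [imPart, hr, smul_neg, neg_neg, inv_smul_smul₀ (by simp)]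

/-- Let `A` be a unital complex C*-algebra, let `a, b ∈ A` be self-adjoint,
and let `ε > 0` satisfy `ε·1 ≤ b`.  Write `Im(x) = (x − x*)/(2i)`.  Then
`Im((a + i·b)⁻¹) ≤ 0`; in fact `−Im((a + i·b)⁻¹)` is positive and invertible, so the
imaginary part of the resolvent is strictly negative. -/
theorem imPart_resolvent_neg_of_imaginary_part_bounded_below
    {A : Type*} [NormedRing A] [StarRing A] [CStarRing A] [CompleteSpace A]
    [NormedAlgebra ℂ A] [StarModule ℂ A] [PartialOrder A] [StarOrderedRing A]
    (a b : A) (ha : IsSelfAdjoint a) (hb : IsSelfAdjoint b)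
    (ε : ℝ) (hε : 0 < ε) (hεb : (ε : ℂ) • (1 : A) ≤ b) :
    IsUnit (a + Complex.I • b) ∧
      imPart (Ring.inverse (a + Complex.I • b)) ≤ 0 ∧
      0 ≤ -imPart (Ring.inverse (a + Complex.I • b)) ∧
      IsUnit (-imPart (Ring.inverse (a + Complex.I • b))) := by
  let _ : CStarAlgebra A := {}
  have hbpos : IsStrictlyPositive b := by
    refine IsStrictlyPositive.of_le (a := (ε : ℂ) • (1 : A)) ?_ hεb
    rw [Complex.coe_smul]
    exact IsStrictlyPositive.smul hε isStrictlyPositive_one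
  have hz : IsUnit (a + Complex.I • b) := hbpos.isUnit_add_I_smul ha
  have hpos : IsStrictlyPositive (-imPart (Ring.inverse (a + Complex.I • b))) := by
    rw [neg_imPart_inverse ha hb hz]
    exact (hz.ringInverse.isStrictlyPositive_star_left_conjugate_iff).mpr hbpos
  exact ⟨hz, neg_nonneg.mp hpos.nonneg, hpos.nonneg, hpos.isUnit⟩
end

section
/- Let μ be the standard Cauchy measure on ℝ. For every z ∈ ℂ with Im z > 0, one has ∫_ℝ (z − t)⁻¹ dμ(t) = (z + i)⁻¹. -/
open MeasureTheory Real

/-- The standard Cauchy measure on `ℝ`: the Borel probability measure with density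
`t ↦ 1/(π(1 + t²))` with respect to Lebesgue measure. -/
noncomputable def cauchyMeasure : Measure ℝ :=
  volume.withDensity fun t => ENNReal.ofReal (1 / (π * (1 + t ^ 2)))

open Filter Topology

lemma ofReal_sub_ne_zero_of_im_pos {w : ℂ} (hw : 0 < w.im) (t : ℝ) : (t : ℂ) - w ≠ 0 := by
  intro h
  have := congrArg Complex.im h
  simp at this
  exact hw.ne' this

lemma ofReal_add_I_ne_zero (t : ℝ) : (t : ℂ) + Complex.I ≠ 0 := fun h => by
  simpa using congrArg Complex.im h

lemma one_add_ofReal_sq (t : ℝ) :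
    1 + (t : ℂ) ^ 2 = (t - Complex.I) * (t + Complex.I) := by
  linear_combination Complex.I_sq

lemma norm_inv_ofReal_sub_le {w : ℂ} (hw : 0 < w.im) (t : ℝ) :
    ‖((t : ℂ) - w)⁻¹‖ ≤ w.im⁻¹ := by
  rw [norm_inv]
  refine inv_anti₀ hw ?_
  simpa [abs_of_pos hw] using Complex.abs_im_le_norm ((t : ℂ) - w)

lemma tendsto_inv_ofReal_sub_cocompact (w : ℂ) :
    Tendsto (fun t : ℝ => ((t : ℂ) - w)⁻¹) (cocompact ℝ) (𝓝 0) := by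
  refine (tendsto_inv₀_cobounded (α := ℂ)).comp ?_
  rw [← Metric.cobounded_eq_cocompact, ← tendsto_norm_atTop_iff_cobounded]
  refine tendsto_atTop_mono (f := fun t : ℝ => ‖t‖ - ‖w‖) (fun t => ?_)
    (tendsto_atTop_add_const_right _ _ tendsto_norm_cobounded_atTop)
  simpa using norm_sub_norm_le (t : ℂ) w

lemma continuous_inv_ofReal_sub {w : ℂ} (hw : 0 < w.im) :
    Continuous fun t : ℝ => ((t : ℂ) - w)⁻¹ :=
  Continuous.inv₀ (by fun_prop) (ofReal_sub_ne_zero_of_im_pos hw)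

/-- For real `t` and `a`, `b` in the upper half-plane, the quotient `(t - a) / (t - b)` avoids the
branch cut of the logarithm. -/
lemma ofReal_sub_div_ofReal_sub_mem_slitPlane {a b : ℂ} (ha : 0 < a.im) (hb : 0 < b.im) (t : ℝ) :
    ((t : ℂ) - a) / ((t : ℂ) - b) ∈ Complex.slitPlane := by
  by_contra h
  rw [Complex.mem_slitPlane_iff, not_or, not_lt, not_not] at h
  have hmul := div_mul_cancel₀ ((t : ℂ) - a) (ofReal_sub_ne_zero_of_im_pos hb t)
  have him := congrArg Complex.im hmul
  rw [Complex.mul_im, h.2] at him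
  simp only [Complex.sub_im, Complex.ofReal_im] at him
  nlinarith [mul_nonneg (neg_nonneg.2 h.1) hb.le]

lemma integrable_inv_ofReal_sub_mul_inv_ofReal_sub_I {z : ℂ} (hz : 0 < z.im) :
    Integrable fun t : ℝ => ((t : ℂ) - z)⁻¹ * ((t : ℂ) - Complex.I)⁻¹ := by
  have hI : 0 < Complex.I.im := by simp
  have hint : Integrable fun t : ℝ => (((1 + t ^ 2)⁻¹ : ℝ) : ℂ) :=
    integrable_inv_one_add_sq.ofReal
  have hb : Integrable fun t : ℝ =>
      (1 + (z + Complex.I) * ((t : ℂ) - z)⁻¹) * (((1 + t ^ 2)⁻¹ : ℝ) : ℂ) := by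
    refine hint.bdd_mul (c := 1 + ‖z + Complex.I‖ * z.im⁻¹) ?_ (ae_of_all _ fun t => ?_)
    · exact (continuous_const.add
        (continuous_const.mul (continuous_inv_ofReal_sub hz))).aestronglyMeasurable
    · refine (norm_add_le _ _).trans ?_
      rw [norm_one, norm_mul]
      gcongr
      exact norm_inv_ofReal_sub_le hz t
  refine hb.congr (ae_of_all _ fun t => ?_)
  have h1 := ofReal_sub_ne_zero_of_im_pos hz t
  have h2 := ofReal_sub_ne_zero_of_im_pos hI t
  have h3 := ofReal_add_I_ne_zero t
  push_cast
  rw [one_add_ofReal_sq]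
  field_simp
  ring

lemma integral_inv_ofReal_sub_mul_inv_ofReal_sub_I {z : ℂ} (hz : 0 < z.im) :
    ∫ t : ℝ, ((t : ℂ) - z)⁻¹ * ((t : ℂ) - Complex.I)⁻¹ = 0 := by
  have hI : 0 < Complex.I.im := by simp
  have hint := integrable_inv_ofReal_sub_mul_inv_ofReal_sub_I hz
  have hsub (w : ℂ) (t : ℝ) : HasDerivAt (fun s : ℝ => (s : ℂ) - w) 1 t :=
    Complex.ofRealCLM.hasDerivAt.sub_const w
  suffices ∃ F : ℝ → ℂ,
      (∀ t : ℝ, HasDerivAt F (((t : ℂ) - z)⁻¹ * ((t : ℂ) - Complex.I)⁻¹) t) ∧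
        Tendsto F (cocompact ℝ) (𝓝 0) by
    obtain ⟨F, hF, hlim⟩ := this
    simpa using integral_of_hasDerivAt_of_tendsto hF hint
      (hlim.mono_left atBot_le_cocompact) (hlim.mono_left atTop_le_cocompact)
  rcases eq_or_ne z Complex.I with rfl | hne
  · refine ⟨fun t => -((t : ℂ) - Complex.I)⁻¹, fun t => ?_, ?_⟩
    · have h := ofReal_sub_ne_zero_of_im_pos hI t
      refine ((hsub Complex.I t).fun_inv h).fun_neg.congr_deriv ?_
      field_simp
    · simpa using (tendsto_inv_ofReal_sub_cocompact Complex.I).neg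
  · have hne' : z - Complex.I ≠ 0 := sub_ne_zero.2 hne
    refine ⟨fun t => (z - Complex.I)⁻¹ *
      Complex.log (((t : ℂ) - z) / ((t : ℂ) - Complex.I)), fun t => ?_, ?_⟩
    · have h1 := ofReal_sub_ne_zero_of_im_pos hz t
      have h2 := ofReal_sub_ne_zero_of_im_pos hI t
      refine ((((hsub z t).fun_div (hsub Complex.I t) h2).clog_real
        (ofReal_sub_div_ofReal_sub_mem_slitPlane hz hI t)).const_mul
          (z - Complex.I)⁻¹).congr_deriv ?_
      field_simp
      ring
    · have hquot : Tendsto (fun t : ℝ => ((t : ℂ) - z) / ((t : ℂ) - Complex.I))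
          (cocompact ℝ) (𝓝 1) := by
        have h := ((tendsto_inv_ofReal_sub_cocompact Complex.I).const_mul
          (Complex.I - z)).const_add 1
        rw [mul_zero, add_zero] at h
        refine h.congr fun t => ?_
        have h2 := ofReal_sub_ne_zero_of_im_pos hI t
        field_simp
        ring
      simpa using (hquot.clog Complex.one_mem_slitPlane).const_mul (z - Complex.I)⁻¹

/-- Let `μ` be the standard Cauchy measure on `ℝ`.  For every `z ∈ ℂ`
with `Im z > 0`, one has `∫_ℝ (z − t)⁻¹ dμ(t) = (z + i)⁻¹`. -/
theorem cauchy_transform_of_cauchyMeasure (z : ℂ) (hz : 0 < z.im) :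
    ∫ t : ℝ, (z - (t : ℂ))⁻¹ ∂cauchyMeasure = (z + Complex.I)⁻¹ := by
  have hI : 0 < Complex.I.im := by simp
  have hzI : z + Complex.I ≠ 0 := fun h => by
    have := congrArg Complex.im h
    simp at this
    linarith
  have hpi : (π : ℂ) ≠ 0 := Complex.ofReal_ne_zero.2 pi_ne_zero
  have hint : Integrable fun t : ℝ => (((1 + t ^ 2)⁻¹ : ℝ) : ℂ) :=
    integrable_inv_one_add_sq.ofReal
  have hcauchy : ∫ t : ℝ, (((1 + t ^ 2)⁻¹ : ℝ) : ℂ) = π := by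
    rw [integral_complex_ofReal, integral_univ_inv_one_add_sq]
  have hdecomp (t : ℝ) :
      (ENNReal.ofReal (1 / (π * (1 + t ^ 2)))).toReal • (z - (t : ℂ))⁻¹ =
        (π : ℂ)⁻¹ * (z + Complex.I)⁻¹ * ((((1 + t ^ 2)⁻¹ : ℝ) : ℂ) -
          ((t : ℂ) - z)⁻¹ * ((t : ℂ) - Complex.I)⁻¹) := by
    rw [ENNReal.toReal_ofReal (by positivity), Complex.real_smul]
    have h1 := ofReal_sub_ne_zero_of_im_pos hz t
    have h1' : z - (t : ℂ) ≠ 0 := by rwa [← neg_sub, neg_ne_zero]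
    have h2 := ofReal_sub_ne_zero_of_im_pos hI t
    have h3 := ofReal_add_I_ne_zero t
    push_cast
    rw [one_add_ofReal_sq]
    field_simp
    ring
  rw [cauchyMeasure, integral_withDensity_eq_integral_toReal_smul (by fun_prop)
    (ae_of_all _ fun _ => ENNReal.ofReal_lt_top)]
  simp_rw [hdecomp]
  rw [integral_const_mul, integral_sub hint (integrable_inv_ofReal_sub_mul_inv_ofReal_sub_I hz),
    integral_inv_ofReal_sub_mul_inv_ofReal_sub_I hz, hcauchy]
  field_simp
  ring
end

section
/- Let μ be the standard Cauchy measure on ℝ and let z₁, …, z_k ∈ ℂ all have strictly positive imaginary part. Then ∫_ℝ ∏_{j=1}^{k} (z_j − t)⁻¹ dμ(t) = ∏_{j=1}^{k} (z_j + i)⁻¹. -/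
open MeasureTheory Real

/-- Integration against the Cauchy measure, in the angular coordinate `t = tan θ`. -/
lemma integral_comp_arctan_cauchyMeasure {E : Type*} [NormedAddCommGroup E] [NormedSpace ℝ E]
    (g : ℝ → E) :
    ∫ t, g (arctan t) ∂cauchyMeasure = π⁻¹ • ∫ θ in -(π / 2)..π / 2, g θ := by
  have hpi := pi_pos
  have hchange := integral_image_eq_integral_abs_deriv_smul MeasurableSet.univ
    (fun x _ => (hasDerivAt_arctan x).hasDerivWithinAt) arctan_injective.injOn g
  rw [Set.image_univ, range_arctan, setIntegral_univ] at hchange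
  rw [intervalIntegral.integral_of_le (by linarith), integral_Ioc_eq_integral_Ioo, hchange,
    ← integral_smul]
  unfold cauchyMeasure
  rw [integral_withDensity_eq_integral_toReal_smul (by fun_prop)
      (Filter.Eventually.of_forall fun _ => ENNReal.ofReal_lt_top)]
  refine integral_congr_ae (Filter.Eventually.of_forall fun t => ?_)
  have ht : 0 < 1 + t ^ 2 := by positivity
  simp only
  rw [ENNReal.toReal_ofReal (by positivity), abs_of_pos (by positivity), smul_smul]
  congr 1
  field_simp

/-- The inverse Cayley transform `(1 - it) / (1 + it)` of `t` is `exp (-2i arctan t)`. -/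
lemma circleMap_neg_two_mul_arctan (t : ℝ) :
    circleMap 0 1 (-2 * arctan t) = (1 - t * Complex.I) / (1 + t * Complex.I) := by
  have hne : (1 + t * Complex.I : ℂ) ≠ 0 := fun h => by
    simpa using congrArg Complex.re h
  have hcos : (cos (arctan t) : ℂ) ≠ 0 := by exact_mod_cast (cos_arctan_pos t).ne'
  have hsin : (sin (arctan t) : ℂ) = t * cos (arctan t) := by
    have h := tan_mul_cos (cos_arctan_pos t).ne'
    rw [tan_arctan] at h
    exact_mod_cast h.symm
  have hpyth : (sin (arctan t) : ℂ) ^ 2 + (cos (arctan t) : ℂ) ^ 2 = 1 := by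
    exact_mod_cast sin_sq_add_cos_sq (arctan t)
  have hexp : Complex.exp (-(arctan t : ℂ) * Complex.I)
      = cos (arctan t) - sin (arctan t) * Complex.I := by
    rw [Complex.exp_mul_I, Complex.cos_neg, Complex.sin_neg, Complex.ofReal_cos,
      Complex.ofReal_sin]
    ring
  have hsq : circleMap 0 1 (-2 * arctan t)
      = Complex.exp (-(arctan t : ℂ) * Complex.I) ^ 2 := by
    rw [← Complex.exp_nat_mul]
    simp [circleMap]
    ring_nf
  rw [hsq, hexp, eq_div_iff hne]
  rw [hsin] at hpyth ⊢
  linear_combination (1 - t * Complex.I) * hpyth -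
    (1 - t * Complex.I) * (cos (arctan t) : ℂ) ^ 2 * t ^ 2 * Complex.I_sq

/-- The Cauchy measure is the image of the uniform measure on the unit circle. -/
lemma integral_cayley_cauchyMeasure {E : Type*} [NormedAddCommGroup E] [NormedSpace ℝ E]
    (F : ℂ → E) :
    ∫ t : ℝ, F ((1 - t * Complex.I) / (1 + t * Complex.I)) ∂cauchyMeasure
      = circleAverage F 0 1 := by
  have hper := ((periodic_circleMap 0 1).comp F).intervalIntegral_add_eq (-π) 0
  simp only [Function.comp_apply, zero_add, show -π + 2 * π = π by ring] at hper
  simp_rw [← circleMap_neg_two_mul_arctan]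
  rw [integral_comp_arctan_cauchyMeasure (fun θ => F (circleMap 0 1 (-2 * θ))),
    intervalIntegral.integral_comp_mul_left (fun θ => F (circleMap 0 1 θ)) (by norm_num),
    show -2 * -(π / 2) = π by ring, show -2 * (π / 2) = -π by ring,
    intervalIntegral.integral_symm, hper, circleAverage_def, smul_neg, smul_neg, smul_smul,
    ← neg_smul]
  congr 1
  field_simp

lemma cayley_denominator_ne_zero {z w : ℂ} (hz : 0 < z.im) (hw : ‖w‖ ≤ 1) :
    (z - Complex.I) * w + (z + Complex.I) ≠ 0 := fun h => by
  have hle : ‖z + Complex.I‖ ≤ ‖z - Complex.I‖ := by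
    rw [eq_neg_of_add_eq_zero_right h, norm_neg, norm_mul]
    exact mul_le_of_le_one_right (norm_nonneg _) hw
  have hsq := pow_le_pow_left₀ (norm_nonneg _) hle 2
  simp only [Complex.sq_norm, Complex.normSq_apply, Complex.add_re, Complex.add_im,
    Complex.sub_re, Complex.sub_im, Complex.I_re, Complex.I_im] at hsq
  nlinarith

/-- The resolvent `(z - t)⁻¹` in the coordinate `w = (1 - it) / (1 + it)`. -/
lemma resolvent_eq_cayley (z : ℂ) (t : ℝ) :
    (z - t)⁻¹ = ((1 - t * Complex.I) / (1 + t * Complex.I) + 1) /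
      ((z - Complex.I) * ((1 - t * Complex.I) / (1 + t * Complex.I)) + (z + Complex.I)) := by
  have hne : (1 + t * Complex.I : ℂ) ≠ 0 := fun h => by
    simpa using congrArg Complex.re h
  have hnum : (1 - t * Complex.I : ℂ) / (1 + t * Complex.I) + 1 = 2 / (1 + t * Complex.I) := by
    field_simp
    ring
  have hden : (z - Complex.I) * ((1 - t * Complex.I) / (1 + t * Complex.I)) + (z + Complex.I)
      = 2 / (1 + t * Complex.I) * (z - t) := by
    rw [← mul_div_assoc, div_add' _ _ _ hne, div_mul_eq_mul_div]
    congr 1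
    linear_combination 2 * (t : ℂ) * Complex.I_sq
  rw [hnum, hden, div_mul_cancel_left₀ (div_ne_zero two_ne_zero hne)]

/-- Let `μ` be the standard Cauchy measure on `ℝ` and let `z₁, …, z_k ∈ ℂ`
all have strictly positive imaginary part.  Then
`∫_ℝ ∏_{j=1}^{k} (z_j − t)⁻¹ dμ(t) = ∏_{j=1}^{k} (z_j + i)⁻¹`. -/
theorem prod_resolvent_integral_cauchyMeasure (k : ℕ) (hk : 1 ≤ k)
    (z : Fin k → ℂ) (hz : ∀ j, 0 < (z j).im) :
    ∫ t : ℝ, ∏ j, (z j - (t : ℂ))⁻¹ ∂cauchyMeasure = ∏ j, (z j + Complex.I)⁻¹ := by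
  let F : ℂ → ℂ := fun w => ∏ j, (w + 1) / ((z j - Complex.I) * w + (z j + Complex.I))
  have hF : ∀ w, ‖w‖ ≤ 1 → DifferentiableAt ℂ F w := fun w hw =>
    DifferentiableAt.fun_finsetProd fun j _ =>
      DifferentiableAt.fun_div (by fun_prop) (by fun_prop) (cayley_denominator_ne_zero (hz j) hw)
  have hmean : circleAverage F 0 1 = F 0 :=
    circleAverage_of_differentiable_on_off_countable Set.countable_empty
      (fun w hw => (hF w (by simpa using hw)).continuousAt.continuousWithinAt)
      (fun w hw => hF w (by simpa using (Metric.ball_subset_closedBall hw.1)))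
  simp_rw [resolvent_eq_cayley]
  rw [integral_cayley_cauchyMeasure F, hmean]
  simp [F]
end

section
/- Let z₁, …, z_n be points of the upper half-plane ℂ⁺. Then there exists a Borel probability measure μ on ℝ such that its reciprocal Cauchy transform F_μ is holomorphic on ℂ⁺ and its complex derivative vanishes at every z_j: F_μ′(z_j) = 0 for j = 1, …, n. In particular, F_μ is not injective on any neighborhood of any of the points z_j. -/
open MeasureTheory

open Filter Topology

/-- The `F`-transform of the measure giving mass `1/2` to each of `a.re ± a.im`; its critical
point in the upper half-plane is `a`. -/
noncomputable def bernoulliF (a w : ℂ) : ℂ := (w - a.re) - (a.im : ℂ) ^ 2 / (w - a.re)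

/-- The Cauchy transform of the finitely supported measure `∑ i, p i • δ_{t i}`. -/
noncomputable def discreteCauchy {ι : Type} [Fintype ι] (p t : ι → ℝ) (w : ℂ) : ℂ :=
  ∑ i, (p i : ℂ) * (w - (t i : ℂ))⁻¹

lemma sub_ofReal_ne_zero {w : ℂ} (hw : 0 < w.im) (x : ℝ) : w - (x : ℂ) ≠ 0 := by
  intro h
  have := congrArg Complex.im h
  simp at this
  exact hw.ne' this

lemma eventually_im_pos {a : ℂ} (ha : 0 < a.im) : ∀ᶠ w in 𝓝 a, 0 < w.im :=
  (Complex.continuous_im.tendsto a).eventually (lt_mem_nhds ha)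

lemma inv_sub_ofReal_im_neg {w : ℂ} (hw : 0 < w.im) (x : ℝ) : ((w - (x : ℂ))⁻¹).im < 0 := by
  rw [Complex.inv_im]
  have := Complex.normSq_pos.2 (sub_ofReal_ne_zero hw x)
  simpa [neg_div] using div_pos hw this

lemma bernoulliF_im_pos {a w : ℂ} (hw : 0 < w.im) : 0 < (bernoulliF a w).im := by
  have h := inv_sub_ofReal_im_neg hw a.re
  have h2 : bernoulliF a w = (w - a.re) - ((a.im ^ 2 : ℝ) : ℂ) * (w - a.re)⁻¹ := by
    simp [bernoulliF, div_eq_mul_inv]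
  rw [h2, Complex.sub_im, Complex.im_ofReal_mul]
  simp only [Complex.sub_im, Complex.ofReal_im, sub_zero]
  nlinarith [sq_nonneg a.im]

lemma analyticAt_bernoulliF (a : ℂ) {w : ℂ} (hw : 0 < w.im) : AnalyticAt ℂ (bernoulliF a) w := by
  have := sub_ofReal_ne_zero hw a.re
  unfold bernoulliF
  fun_prop (disch := assumption)

lemma self_sub_re (a : ℂ) : a - (a.re : ℂ) = a.im * Complex.I := by
  apply Complex.ext <;> simp

lemma hasDerivAt_bernoulliF_self {a : ℂ} (ha : 0 < a.im) : HasDerivAt (bernoulliF a) 0 a := by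
  have h0 := sub_ofReal_ne_zero ha a.re
  have h1 : HasDerivAt (fun w : ℂ => w - (a.re : ℂ)) 1 a := (hasDerivAt_id a).sub_const _
  have h2 := h1.sub ((h1.inv h0).const_mul ((a.im : ℂ) ^ 2))
  have hy : (a.im : ℂ) ≠ 0 := by exact_mod_cast ha.ne'
  refine (h2.congr_deriv ?_).congr_of_eventuallyEq (Eventually.of_forall fun w => ?_)
  · rw [self_sub_re, mul_pow, Complex.I_sq]
    field_simp
    ring
  · simp [bernoulliF, div_eq_mul_inv]

lemma not_injOn_bernoulliF {a : ℂ} (ha : 0 < a.im) {s : Set ℂ} (hs : s ∈ 𝓝 a) :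
    ¬ Set.InjOn (bernoulliF a) s := by
  intro hinj
  have h0 := sub_ofReal_ne_zero ha a.re
  have hy : (a.im : ℂ) ≠ 0 := by exact_mod_cast ha.ne'
  let σ : ℂ → ℂ := fun w => a.re - (a.im : ℂ) ^ 2 / (w - a.re)
  have hσa : σ a = a := by
    have := self_sub_re a
    simp only [σ]
    rw [eq_comm, ← sub_eq_zero]
    field_simp
    rw [this]
    linear_combination (a.im * Complex.I) * this + a.im ^ 2 * Complex.I_sq
  have hσ : ContinuousAt σ a := by
    simp only [σ]
    fun_prop (disch := assumption)
  have hσs : ∀ᶠ w in 𝓝 a, σ w ∈ s := hσ (by rwa [hσa])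
  obtain ⟨w, ⟨⟨hws, hσw⟩, hw⟩, hne⟩ :=
    ((((eventually_mem_set.2 hs).and hσs).and (eventually_im_pos ha)).filter_mono
      nhdsWithin_le_nhds |>.and (self_mem_nhdsWithin : {a}ᶜ ∈ 𝓝[≠] a)).exists
  have hu := sub_ofReal_ne_zero hw a.re
  have heq : w = σ w := by
    refine hinj hws hσw ?_
    simp only [bernoulliF, σ]
    field_simp
    ring_nf
  have hsq : (w - a.re) ^ 2 = (a - a.re) ^ 2 := by
    simp only [σ] at heq
    have h3 : w - a.re = - ((a.im : ℂ) ^ 2 / (w - a.re)) := by linear_combination heq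
    field_simp at h3
    rw [self_sub_re, mul_pow, Complex.I_sq]
    linear_combination h3
  rcases sq_eq_sq_iff_eq_or_eq_neg.1 hsq with h | h
  · exact hne (by simpa using h)
  · have := congrArg Complex.im h
    simp at this
    linarith

lemma not_injOn_comp {f g : ℂ → ℂ} {z : ℂ} (hg : AnalyticAt ℂ g z)
    (hf : ∀ s ∈ 𝓝 (g z), ¬ Set.InjOn f s) {s : Set ℂ} (hs : s ∈ 𝓝 z) :
    ¬ Set.InjOn (f ∘ g) s := by
  intro hinj
  rcases hg.eventually_constant_or_nhds_le_map_nhds with h | h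
  · obtain ⟨w, ⟨hw, hws⟩, hne⟩ := ((h.and hs).filter_mono nhdsWithin_le_nhds |>.and
      (self_mem_nhdsWithin : {z}ᶜ ∈ 𝓝[≠] z)).exists
    exact hne (hinj hws (mem_of_mem_nhds hs) (by simp [hw]))
  · refine hf _ (h (image_mem_map hs)) ?_
    rintro _ ⟨u, hu, rfl⟩ _ ⟨v, hv, rfl⟩ huv
    rw [hinj hu hv huv]

lemma not_injOn_congr {f g : ℂ → ℂ} {z : ℂ} (hfg : f =ᶠ[𝓝 z] g)
    (hg : ∀ s ∈ 𝓝 z, ¬ Set.InjOn g s) {s : Set ℂ} (hs : s ∈ 𝓝 z) : ¬ Set.InjOn f s := fun h =>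
  hg _ (inter_mem hs hfg) ((h.mono Set.inter_subset_left).congr fun _ hw => hw.2)

/-- Composing the resolvent of a real point with `bernoulliF a` gives the Cauchy transform of a
probability measure with two atoms. -/
lemma exists_inv_bernoulliF_sub_eq {a : ℂ} (ha : 0 < a.im) (t : ℝ) :
    ∃ q r : Bool → ℝ, (∀ b, 0 ≤ q b) ∧ ∑ b, q b = 1 ∧
      ∀ w : ℂ, 0 < w.im → discreteCauchy q r w = (bernoulliF a w - t)⁻¹ := by
  obtain ⟨c, d, hc, hd, hsum, hprod⟩ :
      ∃ c d : ℝ, 0 < c ∧ 0 < d ∧ c - d = t ∧ c * d = a.im ^ 2 := by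
    have hsq : √(t ^ 2 + 4 * a.im ^ 2) ^ 2 = t ^ 2 + 4 * a.im ^ 2 := Real.sq_sqrt (by positivity)
    have habs : |t| < √(t ^ 2 + 4 * a.im ^ 2) :=
      abs_lt_of_sq_lt_sq (by rw [hsq]; nlinarith) (Real.sqrt_nonneg _)
    have := abs_lt.1 habs
    refine ⟨(√(t ^ 2 + 4 * a.im ^ 2) + t) / 2, (√(t ^ 2 + 4 * a.im ^ 2) - t) / 2,
      by linarith, by linarith, by ring, by linear_combination hsq / 4⟩
  have hcd : 0 < c + d := by positivity
  refine ⟨fun b => (bif b then c else d) / (c + d), fun b => bif b then a.re + c else a.re - d,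
    ?_, ?_, fun w hw => ?_⟩
  · rintro (_ | _) <;> simp <;> positivity
  · simp
    field_simp
  · have hu := sub_ofReal_ne_zero hw a.re
    have h1 := sub_ofReal_ne_zero hw (a.re + c)
    have h2 := sub_ofReal_ne_zero hw (a.re - d)
    have h3 := sub_ofReal_ne_zero (bernoulliF_im_pos (a := a) hw) t
    have hcd' : (c : ℂ) + d ≠ 0 := by exact_mod_cast hcd.ne'
    have hfac : (bernoulliF a w - t) * (w - a.re) =
        (w - (a.re + c : ℝ)) * (w - (a.re - d : ℝ)) := by
      have hp : (c : ℂ) * d = (a.im : ℂ) ^ 2 := by exact_mod_cast hprod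
      simp only [bernoulliF, ← hp, ← hsum]
      push_cast
      field_simp
      ring
    rw [show (bernoulliF a w - t)⁻¹ = (w - a.re) /
        ((w - (a.re + c : ℝ)) * (w - (a.re - d : ℝ))) by rw [← hfac]; field_simp]
    simp only [discreteCauchy, Fintype.sum_bool, cond_true, cond_false]
    push_cast at *
    field_simp
    ring

lemma differentiableAt_discreteCauchy {ι : Type} [Fintype ι] (p t : ι → ℝ) {w : ℂ}
    (hw : 0 < w.im) : DifferentiableAt ℂ (discreteCauchy p t) w := by
  have h0 := fun i => sub_ofReal_ne_zero hw (t i)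
  unfold discreteCauchy
  fun_prop (disch := exact h0 _)

lemma exists_discreteCauchy_crit_points (n : ℕ) (z : Fin n → ℂ) (hz : ∀ j, 0 < (z j).im) :
    ∃ (ι : Type) (_ : Fintype ι) (p t : ι → ℝ), (∀ i, 0 ≤ p i) ∧ ∑ i, p i = 1 ∧
      ∀ j, HasDerivAt (discreteCauchy p t) 0 (z j) ∧
        ∀ s ∈ 𝓝 (z j), ¬ Set.InjOn (discreteCauchy p t) s := by
  induction n with
  | zero => exact ⟨Unit, inferInstance, 1, 0, by simp, by simp, fun j => j.elim0⟩
  | succ n ih =>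
    have ha := hz 0
    obtain ⟨ι, _, p, t, hp, hp1, hcrit⟩ := ih (fun j => bernoulliF (z 0) (z j.succ))
      fun j => bernoulliF_im_pos (hz _)
    choose q r hq hq1 hqr using fun i => exists_inv_bernoulliF_sub_eq ha (t i)
    refine ⟨ι × Bool, inferInstance, fun k => p k.1 * q k.1 k.2, fun k => r k.1 k.2,
      fun k => mul_nonneg (hp _) (hq _ _), ?_, fun j => ?_⟩
    · simp only [Fintype.sum_prod_type, ← Finset.mul_sum, hq1, mul_one, hp1]
    have heq : discreteCauchy (fun k : ι × Bool => p k.1 * q k.1 k.2) (fun k => r k.1 k.2)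
        =ᶠ[𝓝 (z j)] discreteCauchy p t ∘ bernoulliF (z 0) := by
      filter_upwards [eventually_im_pos (hz j)] with w hw
      simp only [Function.comp_apply, discreteCauchy, Fintype.sum_prod_type]
      refine Finset.sum_congr rfl fun i _ => ?_
      rw [← hqr i w hw, discreteCauchy, Finset.mul_sum]
      exact Finset.sum_congr rfl fun b _ => by push_cast; ring
    suffices h : HasDerivAt (discreteCauchy p t ∘ bernoulliF (z 0)) 0 (z j) ∧
        ∀ s ∈ 𝓝 (z j), ¬ Set.InjOn (discreteCauchy p t ∘ bernoulliF (z 0)) s from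
      ⟨h.1.congr_of_eventuallyEq heq, fun s hs => not_injOn_congr heq h.2 hs⟩
    refine Fin.cases ⟨?_, fun s hs h => ?_⟩ (fun j => ⟨?_, fun s hs => ?_⟩) j
    · simpa using (differentiableAt_discreteCauchy p t
        (bernoulliF_im_pos ha)).hasDerivAt.comp (z 0) (hasDerivAt_bernoulliF_self ha)
    · exact not_injOn_bernoulliF ha hs fun u hu v hv huv => h hu hv (congrArg (discreteCauchy p t) huv)
    · have hB := analyticAt_bernoulliF (z 0) (hz j.succ)
      simpa using (hcrit j).1.comp (z j.succ) hB.differentiableAt.hasDerivAt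
    · exact not_injOn_comp (analyticAt_bernoulliF (z 0) (hz j.succ)) (hcrit j).2 hs

lemma discreteCauchy_ne_zero {ι : Type} [Fintype ι] {p : ι → ℝ} (t : ι → ℝ) (hp : ∀ i, 0 ≤ p i)
    (hp1 : ∑ i, p i = 1) {w : ℂ} (hw : 0 < w.im) : discreteCauchy p t w ≠ 0 := by
  intro h
  have him : ∑ i, p i * ((w - (t i : ℂ))⁻¹).im = 0 := by
    simpa only [discreteCauchy, Complex.im_sum, Complex.im_ofReal_mul, Complex.zero_im]
      using congrArg Complex.im h
  have hz := (Finset.sum_eq_zero_iff_of_nonpos fun i _ => mul_nonpos_of_nonneg_of_nonpos (hp i)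
    (inv_sub_ofReal_im_neg hw (t i)).le).1 him
  have : ∑ i, p i = 0 := Finset.sum_eq_zero fun i hi =>
    (mul_eq_zero.1 (hz i hi)).resolve_right (inv_sub_ofReal_im_neg hw (t i)).ne
  linarith

lemma integral_sum_dirac {ι : Type} [Fintype ι] {p : ι → ℝ} (t : ι → ℝ) (hp : ∀ i, 0 ≤ p i)
    (f : ℝ → ℂ) :
    ∫ x, f x ∂(∑ i, ENNReal.ofReal (p i) • Measure.dirac (t i)) = ∑ i, (p i : ℂ) * f (t i) := by
  rw [integral_finsetSum_measure fun i _ =>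
    (integrable_dirac (by simp [enorm_lt_top])).smul_measure ENNReal.ofReal_ne_top]
  exact Finset.sum_congr rfl fun i _ => by
    rw [integral_smul_measure, integral_dirac, ENNReal.toReal_ofReal (hp i), Complex.real_smul]

/-- Let `z₁, …, z_n` be points of the upper half-plane `ℂ⁺`.  Then there
exists a Borel probability measure `μ` on `ℝ` such that its reciprocal Cauchy transform
`F_μ` is holomorphic on `ℂ⁺` and its complex derivative vanishes at every `z_j`.
In particular, `F_μ` is not injective on any neighborhood of any of the points `z_j`. -/
theorem exists_measure_F_transform_crit_points (n : ℕ) (z : Fin n → ℂ)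
    (hz : ∀ j, 0 < (z j).im) :
    ∃ μ : Measure ℝ, IsProbabilityMeasure μ ∧
      DifferentiableOn ℂ (fun w => (∫ t : ℝ, (w - (t : ℂ))⁻¹ ∂μ)⁻¹) {w : ℂ | 0 < w.im} ∧
      (∀ j, HasDerivAt (fun w => (∫ t : ℝ, (w - (t : ℂ))⁻¹ ∂μ)⁻¹) 0 (z j)) ∧
      (∀ j, ∀ s ∈ nhds (z j), ¬ Set.InjOn (fun w => (∫ t : ℝ, (w - (t : ℂ))⁻¹ ∂μ)⁻¹) s) := by
  obtain ⟨ι, _, p, t, hp, hp1, hcrit⟩ := exists_discreteCauchy_crit_points n z hz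
  have hG : (fun w : ℂ => (∫ x : ℝ, (w - (x : ℂ))⁻¹
      ∂(∑ i, ENNReal.ofReal (p i) • Measure.dirac (t i)))⁻¹) =
      fun w => (discreteCauchy p t w)⁻¹ := by
    funext w
    rw [integral_sum_dirac t hp, discreteCauchy]
  refine ⟨∑ i, ENNReal.ofReal (p i) • Measure.dirac (t i), ⟨?_⟩, ?_⟩
  · simp [← ENNReal.ofReal_sum_of_nonneg fun i _ => hp i, hp1]
  rw [hG]
  refine ⟨fun w hw => ?_, fun j => ?_, fun j s hs h => ?_⟩
  · exact ((differentiableAt_discreteCauchy p t hw).inv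
      (discreteCauchy_ne_zero t hp hp1 hw)).differentiableWithinAt
  · exact ((hcrit j).1.inv (discreteCauchy_ne_zero t hp hp1 (hz j))).congr_deriv (by simp)
  · exact (hcrit j).2 s hs fun u hu v hv huv => h hu hv (congrArg _ huv)
end
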